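/- Let θ = (√5−1)/2 and let γ(m) = {mθ} denote the fractional part of mθ. Then for every integer n ≥ 2 and all integers i, j with 0 ≤ i ≤ L_{2n+1} − 2 and 0 ≤ j ≤ F_{2n} − 1, we have γ(F_{4n}·i + L_{2n}·j + F_{2n−1}) = (γ(F_{4n}) − 1)·i + γ(L_{2n})·j + γ(F_{2n−1}), and γ(F_{4n}·i + L_{2n}·j + L_{2n}) = (γ(F_{4n}) − 1)·i + γ(L_{2n})·j + γ(L_{2n}). -/

import Mathlib

/-- The Lucas numbers: `L_0 = 2`, `L_1 = 1`, `L_n = L_{n-1} + L_{n-2}`. -/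
def lucas : ℕ → ℕ
  | 0 => 2
  | 1 => 1
  | n + 2 => lucas (n + 1) + lucas n

/-- `γ(m) = {mθ}` for `θ = (√5-1)/2`. -/
noncomputable def gammaFrac (m : ℕ) : ℝ := Int.fract ((m : ℝ) * ((Real.sqrt 5 - 1) / 2))

theorem lucas_succ_eq_fib_add_fib (k : ℕ) : lucas (k + 1) = Nat.fib k + Nat.fib (k + 2) := by
  induction k using Nat.twoStepInduction with
  | zero => simp [lucas]
  | one => simp [lucas, Nat.fib_add_two]
  | more k ih₀ ih₁ =>
    rw [lucas, ih₀, ih₁]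
    simp only [Nat.fib_add_two]
    ring

theorem fib_mul_eq_sub_neg_pow {θ : ℝ} (hθ : θ ^ 2 = 1 - θ) (k : ℕ) :
    (Nat.fib k : ℝ) * θ = Nat.fib (k + 1) - Nat.fib k - (-θ) ^ k := by
  induction k with
  | zero => simp
  | succ k ih =>
    rw [Nat.fib_add_two, pow_succ]
    push_cast
    linear_combination (-θ) * ih + (Nat.fib k : ℝ) * hθ

theorem fib_succ_add_fib_mul_mul_pow {θ : ℝ} (hθ : θ ^ 2 = 1 - θ) (k : ℕ) :
    ((Nat.fib (k + 1) : ℝ) + Nat.fib k * θ) * θ ^ k = 1 := by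
  induction k with
  | zero => simp
  | succ k ih =>
    rw [Nat.fib_add_two, pow_succ]
    push_cast
    linear_combination ih + (Nat.fib (k + 1) : ℝ) * θ ^ k * hθ

theorem gammaFrac_eq_of_mul_eq {m : ℕ} {r : ℝ} (p : ℤ)
    (h : (m : ℝ) * ((Real.sqrt 5 - 1) / 2) = p + r) (h₀ : 0 ≤ r) (h₁ : r < 1) :
    gammaFrac m = r :=
  Int.fract_eq_iff.2 ⟨h₀, h₁, p, by rw [h]; ring⟩

/-- **Lemma 9.**  For `n ≥ 2`, `0 ≤ i ≤ L_{2n+1} - 2` and `0 ≤ j ≤ F_{2n} - 1`: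
`γ(F_{4n}·i + L_{2n}·j + F_{2n-1}) = (γ(F_{4n}) - 1)·i + γ(L_{2n})·j + γ(F_{2n-1})` and
`γ(F_{4n}·i + L_{2n}·j + L_{2n}) = (γ(F_{4n}) - 1)·i + γ(L_{2n})·j + γ(L_{2n})`. -/
theorem gamma_array (n : ℕ) (hn : 2 ≤ n) (i j : ℕ)
    (hi : i ≤ lucas (2 * n + 1) - 2) (hj : j ≤ Nat.fib (2 * n) - 1) :
    gammaFrac (Nat.fib (4 * n) * i + lucas (2 * n) * j + Nat.fib (2 * n - 1)) =
      (gammaFrac (Nat.fib (4 * n)) - 1) * (i : ℝ) + gammaFrac (lucas (2 * n)) * (j : ℝ) +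
        gammaFrac (Nat.fib (2 * n - 1)) ∧
    gammaFrac (Nat.fib (4 * n) * i + lucas (2 * n) * j + lucas (2 * n)) =
      (gammaFrac (Nat.fib (4 * n)) - 1) * (i : ℝ) + gammaFrac (lucas (2 * n)) * (j : ℝ) +
        gammaFrac (lucas (2 * n)) := by
  set θ : ℝ := (Real.sqrt 5 - 1) / 2 with hθdef
  have h5 : Real.sqrt 5 ^ 2 = 5 := Real.sq_sqrt (by norm_num)
  have hθ : θ ^ 2 = 1 - θ := by rw [hθdef]; linear_combination h5 / 4
  have hθ0 : 0 < θ := by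
    have : (1 : ℝ) < Real.sqrt 5 := Real.lt_sqrt_of_sq_lt (by norm_num)
    rw [hθdef]; linarith
  have hL₁ : lucas (2 * n + 1) = 2 * Nat.fib (2 * n) + Nat.fib (2 * n + 1) := by
    rw [lucas_succ_eq_fib_add_fib, Nat.fib_add_two]; ring
  obtain ⟨m, hm⟩ : ∃ m, 2 * n = m + 1 := ⟨2 * n - 1, by omega⟩
  have hG : Nat.fib (2 * n + 1) = Nat.fib (2 * n - 1) + Nat.fib (2 * n) := by
    rw [hm, Nat.fib_add_two, Nat.add_sub_cancel]
  have hL₀ : lucas (2 * n) = 2 * Nat.fib (2 * n - 1) + Nat.fib (2 * n) := by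
    rw [hm, lucas_succ_eq_fib_add_fib, Nat.fib_add_two, Nat.add_sub_cancel]; ring
  have hF : 0 < Nat.fib (2 * n) := Nat.fib_pos.2 (by omega)
  have hi' : i ≤ 2 * Nat.fib (2 * n) + Nat.fib (2 * n + 1) := by omega
  have hj' : j + 1 ≤ Nat.fib (2 * n) := by omega
  have hA := fib_mul_eq_sub_neg_pow hθ (2 * n)
  have hB := fib_succ_add_fib_mul_mul_pow hθ (2 * n)
  have hC := fib_mul_eq_sub_neg_pow hθ (4 * n)
  rw [show 4 * n = 2 * n * 2 by ring, pow_mul, (even_two_mul n).neg_pow] at hC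
  rw [(even_two_mul n).neg_pow] at hA
  rw [show 4 * n = 2 * n * 2 by ring, hL₀]
  rw [hG] at hA hB hi'
  have hx : 0 < θ ^ (2 * n) := by positivity
  generalize θ ^ (2 * n) = x at *
  generalize Nat.fib (2 * n) = F at *
  generalize Nat.fib (2 * n - 1) = H at *
  generalize Nat.fib (2 * n * 2 + 1) = E at *
  generalize Nat.fib (2 * n * 2) = D at *
  have hi'' : (i : ℝ) ≤ 2 * F + (H + F) := by exact_mod_cast hi'
  have hj'' : (j : ℝ) + 1 ≤ F := by exact_mod_cast hj'
  push_cast at hA hB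
  have hH : (H : ℝ) * θ = F - H + x * (1 + θ) := by
    linear_combination F * hθ - (1 + θ) * hA
  have hsum : (1 + 2 * θ) * x * F = 1 - x ^ 2 := by
    linear_combination hB + x * hA
  have hlower : x ^ 2 * i ≤ x * (1 + θ) := by
    have h₁ : x ^ 2 * i ≤ x ^ 2 * (2 * F + (H + F)) := by gcongr
    have h₂ : x ^ 2 * (2 * F + (H + F)) = x * (1 + θ) - θ * x ^ 3 := by
      linear_combination x * (1 + θ) * hsum - x ^ 2 * hA - 2 * x ^ 2 * F * hθ
    have h₃ : 0 < θ * x ^ 3 := by positivity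
    linarith
  have hupper : (1 + 2 * θ) * x * (j + 1) < 1 := by
    have h₁ : (1 + 2 * θ) * x * (j + 1) ≤ (1 + 2 * θ) * x * F := by gcongr
    have h₂ : 0 < x ^ 2 := by positivity
    linarith
  have hθx : 0 < θ * x := by positivity
  have hjx : 0 ≤ (1 + 2 * θ) * x * j := by positivity
  have hix : 0 ≤ x ^ 2 * i := by positivity
  have hx1 : x ^ 2 ≤ 1 := by nlinarith
  have hγD : gammaFrac D = 1 - x ^ 2 :=
    gammaFrac_eq_of_mul_eq (E - D - 1) (by push_cast; linear_combination hC)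
      (by linarith) (by nlinarith)
  have hγL : gammaFrac (2 * H + F) = (1 + 2 * θ) * x :=
    gammaFrac_eq_of_mul_eq (2 * F - H) (by push_cast; linear_combination 2 * hH + hA)
      (by positivity) (by linarith)
  have hγH : gammaFrac H = x * (1 + θ) :=
    gammaFrac_eq_of_mul_eq (F - H) (by push_cast; linear_combination hH)
      (by positivity) (by linarith)
  rw [hγD, hγL, hγH]
  constructor
  · refine gammaFrac_eq_of_mul_eq ((E - D) * i + (2 * F - H) * j + (F - H)) ?_ ?_ ?_
    · push_cast
      linear_combination i * hC + j * (2 * hH + hA) + hH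
    · linarith
    · linarith
  · refine gammaFrac_eq_of_mul_eq ((E - D) * i + (2 * F - H) * j + (2 * F - H)) ?_ ?_ ?_
    · push_cast
      linear_combination i * hC + j * (2 * hH + hA) + (2 * hH + hA)
    · linarith
    · linarith
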